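/- arXiv:2405.11073 — 11 statements merged into one kernel-verified Lean document; each statement's English description precedes it below -/
import Mathlib

section
/- For all sets A, B, C, the family ⫫_{A,B|C}(Ω) := {(X, Y, Z) ∈ (NV(A) × NV(B) × NV(C))(Ω) | X ⫫ Y | Z} defines a subsheaf of NV(A) × NV(B) × NV(C) on 𝕊ur: (closure) if X ⫫ Y | Z and p: Ω' → Ω is a surjection of nonempty finite sets, then X∘p ⫫ Y∘p | Z∘p; and (reflection) if X∘p ⫫ Y∘p | Z∘p for some surjection p: Ω' → Ω, then X ⫫ Y | Z. -/
/-- Conditional independence of nondeterministic variables. -/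
def CondIndep {Ω A B C : Type} (X : Ω → A) (Y : Ω → B) (Z : Ω → C) : Prop :=
  ∀ (a : A) (b : B) (c : C),
    (∃ ω, X ω = a ∧ Z ω = c) → (∃ ω, Y ω = b ∧ Z ω = c) →
    ∃ ω, X ω = a ∧ Y ω = b ∧ Z ω = c

/-- Conditional independence is invariant under precomposition with a surjection. -/
theorem condIndep_comp_iff {Ω Ω' A B C : Type} (X : Ω → A) (Y : Ω → B) (Z : Ω → C)
    {p : Ω' → Ω} (hp : Function.Surjective p) :
    CondIndep (X ∘ p) (Y ∘ p) (Z ∘ p) ↔ CondIndep X Y Z := by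
  simp only [CondIndep, hp.exists, Function.comp_apply]

/-- conditional independence defines a subsheaf of
`NV(A) × NV(B) × NV(C)` on 𝕊ur: closure and reflection along surjections. -/
theorem stmt_3 (A B C : Type) {Ω Ω' : Type} [Finite Ω] [Nonempty Ω] [Finite Ω'] [Nonempty Ω']
    (X : Ω → A) (Y : Ω → B) (Z : Ω → C) (p : Ω' → Ω) (hp : Function.Surjective p) :
    (CondIndep X Y Z → CondIndep (X ∘ p) (Y ∘ p) (Z ∘ p)) ∧
    (CondIndep (X ∘ p) (Y ∘ p) (Z ∘ p) → CondIndep X Y Z) := by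
  exact ⟨(condIndep_comp_iff X Y Z hp).mpr, (condIndep_comp_iff X Y Z hp).mp⟩
end

section
/- Let C be a small coconfluent category and P an atomic sheaf on C. Then the family ~_P(X) := {(x, x') ∈ P(X) × P(X) | there exist an object Z and morphisms u, u': Z → X with x·u = x'·u'} defines a subsheaf of P × P ((closure) (x, x') ∈ ~_P(X) and f: Y → X imply (x·f, x'·f) ∈ ~_P(Y); (reflection) (x·f, x'·f) ∈ ~_P(Y) for some f: Y → X implies (x, x') ∈ ~_P(X)), and moreover ~_P(X) is an equivalence relation on P(X) for every object X. -/
open CategoryTheory Opposite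

universe u v w

/-- Right Ore condition: every cospan completes to a commuting span. -/
def Coconfluent (C : Type u) [Category.{v} C] : Prop :=
  ∀ ⦃X Y Z : C⦄ (f : X ⟶ Z) (g : Y ⟶ Z),
    ∃ (W : C) (u : W ⟶ X) (v : W ⟶ Y), u ≫ f = v ≫ g

/-- A presheaf is an atomic sheaf if every invariant element has a unique descendent. -/
def IsAtomicSheaf {C : Type u} [Category.{v} C] (P : Cᵒᵖ ⥤ Type w) : Prop :=
  ∀ ⦃X Y : C⦄ (c : Y ⟶ X) (y : P.obj (op Y)),
    (∀ ⦃Z : C⦄ (d e : Z ⟶ Y), d ≫ c = e ≫ c → P.map d.op y = P.map e.op y) →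
    ∃! x : P.obj (op X), y = P.map c.op x

/-- The atomic equivalence relation on a presheaf. -/
def AtomicEquiv {C : Type u} [Category.{v} C] (P : Cᵒᵖ ⥤ Type w) {X : C}
    (x x' : P.obj (op X)) : Prop :=
  ∃ (Z : C) (u u' : Z ⟶ X), P.map u.op x = P.map u'.op x'

/-- for a small coconfluent category `C` and an atomic sheaf `P` on `C`,
atomic equivalence defines a subsheaf of `P × P` (closure and reflection) and is an
equivalence relation on each `P(X)`. -/
theorem stmt_4 {C : Type u} [SmallCategory C] (hC : Coconfluent C)
    (P : Cᵒᵖ ⥤ Type u) (hP : IsAtomicSheaf P) :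
    (∀ {X Y : C} (f : Y ⟶ X) (x x' : P.obj (op X)),
      AtomicEquiv P x x' → AtomicEquiv P (P.map f.op x) (P.map f.op x')) ∧
    (∀ {X Y : C} (f : Y ⟶ X) (x x' : P.obj (op X)),
      AtomicEquiv P (P.map f.op x) (P.map f.op x') → AtomicEquiv P x x') ∧
    (∀ X : C, Equivalence (fun x x' : P.obj (op X) => AtomicEquiv P x x')) := by
  refine ⟨?_, ?_, fun X => ⟨?_, ?_, ?_⟩⟩
  · rintro X Y f x x' ⟨Z, u, u', h⟩
    obtain ⟨W, a, b, hab⟩ := hC f u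
    obtain ⟨V, c, d, hcd⟩ := hC (b ≫ u') f
    refine ⟨V, c ≫ a, d, ?_⟩
    calc P.map (c ≫ a).op (P.map f.op x) = P.map (c ≫ (a ≫ f)).op x := by simp
      _ = P.map (c ≫ b).op (P.map u.op x) := by rw [hab]; simp
      _ = P.map (c ≫ b).op (P.map u'.op x') := by rw [h]
      _ = P.map (c ≫ (b ≫ u')).op x' := by simp
      _ = P.map d.op (P.map f.op x') := by rw [hcd]; simp
  · rintro X Y f x x' ⟨Z, u, u', h⟩
    exact ⟨Z, u ≫ f, u' ≫ f, by simpa using h⟩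
  · exact fun x => ⟨X, 𝟙 X, 𝟙 X, rfl⟩
  · rintro x x' ⟨Z, u, u', h⟩
    exact ⟨Z, u', u, h.symm⟩
  · rintro x x' x'' ⟨Z, u, u', h⟩ ⟨Z', v, v', h'⟩
    obtain ⟨W, a, b, hab⟩ := hC u' v
    refine ⟨W, a ≫ u, b ≫ v', ?_⟩
    calc P.map (a ≫ u).op x = P.map a.op (P.map u.op x) := by simp
      _ = P.map (a ≫ u').op x' := by rw [h]; simp
      _ = P.map b.op (P.map v.op x') := by rw [hab]; simp
      _ = P.map (b ≫ v').op x'' := by rw [h']; simp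
end

section
/- For every set A, every nonempty finite set Ω and all functions X, X': Ω → A, the following are equivalent: (i) X(Ω) = X'(Ω) (equiextension); (ii) there exist a nonempty finite set Ω' and surjections u, u': Ω' → Ω with X∘u = X'∘u'. Hence on the sheaf NV(A) in Sh_at(𝕊ur), the atomic equivalence relation ~_{NV(A)} coincides with the equiextension relation ⋈_A. -/
/-- for functions `X X' : Ω → A` on a nonempty finite set, equiextension
(equal images) holds iff there are surjections `u u' : Ω' → Ω` from a nonempty finite
set with `X ∘ u = X' ∘ u'`.  Hence atomic equivalence on `NV(A)` coincides with
equiextension. -/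
theorem stmt_5 (A : Type) (Ω : Type) [Finite Ω] [Nonempty Ω] (X X' : Ω → A) :
    Set.range X = Set.range X' ↔
    ∃ (Ω' : Type) (_ : Finite Ω') (_ : Nonempty Ω') (u u' : Ω' → Ω),
      Function.Surjective u ∧ Function.Surjective u' ∧ X ∘ u = X' ∘ u' := by
  constructor
  · intro h
    let P := {p : Ω × Ω // X p.1 = X' p.2}
    have hfst : Function.Surjective fun p : P => p.1.1 := fun ω => by
      obtain ⟨ω', hω'⟩ : X ω ∈ Set.range X' := h ▸ Set.mem_range_self ω
      exact ⟨⟨(ω, ω'), hω'.symm⟩, rfl⟩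
    have hsnd : Function.Surjective fun p : P => p.1.2 := fun ω' => by
      obtain ⟨ω, hω⟩ : X' ω' ∈ Set.range X := h ▸ Set.mem_range_self ω'
      exact ⟨⟨(ω, ω'), hω⟩, rfl⟩
    exact ⟨P, Subtype.finite, hfst.nonempty, _, _, hfst, hsnd, funext fun p => p.2⟩
  · rintro ⟨Ω', _, _, u, u', hu, hu', h⟩
    rw [← hu.range_comp X, h, hu'.range_comp X']
end

section
/- A commuting square of surjections of nonempty finite sets, r∘p = s∘q with p: Ω → Ω_Y, q: Ω → Ω_Z, r: Ω_Y → Ω_W, s: Ω_Z → Ω_W, satisfies p ⫫ q | r∘p (conditional independence of p and q, as functions on Ω, given r∘p) if and only if it is a weak pullback in Set, i.e., for all y ∈ Ω_Y and z ∈ Ω_Z with r(y) = s(z) there exists ω ∈ Ω with p(ω) = y and q(ω) = z. -/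
/-- a commuting square of surjections of nonempty finite sets satisfies
`p ⫫ q | r ∘ p` iff it is a weak pullback in Set. -/
theorem stmt_8 {Ω ΩY ΩZ ΩW : Type} [Finite Ω] [Nonempty Ω] [Finite ΩY] [Nonempty ΩY]
    [Finite ΩZ] [Nonempty ΩZ] [Finite ΩW] [Nonempty ΩW]
    (p : Ω → ΩY) (q : Ω → ΩZ) (r : ΩY → ΩW) (s : ΩZ → ΩW)
    (hp : Function.Surjective p) (hq : Function.Surjective q)
    (hr : Function.Surjective r) (hs : Function.Surjective s)
    (hcomm : r ∘ p = s ∘ q) :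
    CondIndep p q (r ∘ p) ↔
      ∀ (y : ΩY) (z : ΩZ), r y = s z → ∃ ω, p ω = y ∧ q ω = z := by
  have comm (ω : Ω) : r (p ω) = s (q ω) := congrFun hcomm ω
  constructor
  · intro h y z hyz
    obtain ⟨ω₁, rfl⟩ := hp y
    obtain ⟨ω₂, rfl⟩ := hq z
    obtain ⟨ω, hy, hz, -⟩ := h (p ω₁) (q ω₂) (r (p ω₁)) ⟨ω₁, rfl, rfl⟩
      ⟨ω₂, rfl, (comm ω₂).trans hyz.symm⟩
    exact ⟨ω, hy, hz⟩
  · rintro h _ _ _ ⟨ω₁, rfl, rfl⟩ ⟨ω₂, rfl, hω⟩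
    obtain ⟨ω, hy, hz⟩ := h (p ω₁) (q ω₂) (hω.symm.trans (comm ω₂))
    exact ⟨ω, hy, hz, congrArg r hy⟩
end

section
/- Let C be a small category equipped with an independent pullback structure. For a presheaf P on C the following are equivalent: (1) P is an atomic sheaf; (2) P maps independent squares in C to pullback squares in Set, i.e., for every independent square u∘f = v∘g (f: X → Y, g: X → Z, u: Y → W, v: Z → W) and all y ∈ P(Y), z ∈ P(Z) with y·f = z·g, there exists a unique w ∈ P(W) with w·u = y and w·v = z. -/
open CategoryTheory Opposite

universe u v w

/-- An independent pullback structure on a category `C`: a collection of commuting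
squares (`Ind f g u v` for a square `f ≫ u = g ≫ v` with `f : X ⟶ Y`, `g : X ⟶ Z`,
`u : Y ⟶ W`, `v : Z ⟶ W`), satisfying axioms (IP1)-(IP5).  An independent pullback is
an independent square through which every independent square on the same cospan factors
uniquely; this notion is inlined in the axioms (IP4) and (IP5). -/
structure IndepStructure (C : Type u) [Category.{v} C] where
  /-- The collection of independent squares. -/
  Ind : ∀ {X Y Z W : C}, (X ⟶ Y) → (X ⟶ Z) → (Y ⟶ W) → (Z ⟶ W) → Prop
  /-- Independent squares commute. -/
  comm : ∀ {X Y Z W : C} {f : X ⟶ Y} {g : X ⟶ Z} {u : Y ⟶ W} {v : Z ⟶ W},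
    Ind f g u v → f ≫ u = g ≫ v
  /-- (IP1) degenerate squares are independent. -/
  ip1 : ∀ {X Y : C} (f : X ⟶ Y), Ind f (𝟙 X) (𝟙 Y) f
  /-- (IP2) independence is preserved by transposition. -/
  ip2 : ∀ {X Y Z W : C} {f : X ⟶ Y} {g : X ⟶ Z} {u : Y ⟶ W} {v : Z ⟶ W},
    Ind f g u v → Ind g f v u
  /-- (IP3) horizontal pasting of independent squares is independent. -/
  ip3 : ∀ {X Y Z W Y' W' : C} {f : X ⟶ Y} {g : X ⟶ Z} {u : Y ⟶ W} {v : Z ⟶ W}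
    {f' : Y ⟶ Y'} {u' : Y' ⟶ W'} {v' : W ⟶ W'},
    Ind f g u v → Ind f' u u' v' → Ind (f ≫ f') g u' (v ≫ v')
  /-- (IP4) if a pasted rectangle is independent and the second square is an independent
  pullback then the first (commuting) square is independent. -/
  ip4 : ∀ {X Y Z W Y' W' : C} {f : X ⟶ Y} {g : X ⟶ Z} {u : Y ⟶ W} {v : Z ⟶ W}
    {f' : Y ⟶ Y'} {u' : Y' ⟶ W'} {v' : W ⟶ W'},
    f ≫ u = g ≫ v →
    Ind (f ≫ f') g u' (v ≫ v') →
    (Ind f' u u' v' ∧ ∀ {V : C} (f'' : V ⟶ Y') (g'' : V ⟶ W), Ind f'' g'' u' v' →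
      ∃! h : V ⟶ Y, h ≫ f' = f'' ∧ h ≫ u = g'') →
    Ind f g u v
  /-- (IP5) every cospan completes to an independent pullback. -/
  ip5 : ∀ {Y Z W : C} (u : Y ⟶ W) (v : Z ⟶ W),
    ∃ (X : C) (f : X ⟶ Y) (g : X ⟶ Z),
      Ind f g u v ∧ ∀ {V : C} (f' : V ⟶ Y) (g' : V ⟶ Z), Ind f' g' u v →
        ∃! h : V ⟶ X, h ≫ f = f' ∧ h ≫ g = g'

/-- A square is an independent pullback if it is independent and every independent
square on the same cospan factors through it uniquely. -/
def IndepStructure.IsIndepPullback {C : Type u} [Category.{v} C] (S : IndepStructure C)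
    {X Y Z W : C} (f : X ⟶ Y) (g : X ⟶ Z) (u : Y ⟶ W) (v : Z ⟶ W) : Prop :=
  S.Ind f g u v ∧ ∀ {V : C} (f' : V ⟶ Y) (g' : V ⟶ Z), S.Ind f' g' u v →
    ∃! h : V ⟶ X, h ≫ f = f' ∧ h ≫ g = g'

/-- The descent property of an independent pullback structure. -/
def IndepStructure.Descent {C : Type u} [Category.{v} C] (S : IndepStructure C) : Prop :=
  ∀ {X Y Z W V : C} (f : X ⟶ Y) (g : X ⟶ Z) (u : Y ⟶ W) (v : Z ⟶ W) (h : V ⟶ X),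
    f ≫ u = g ≫ v → S.Ind (h ≫ f) (h ≫ g) u v → S.Ind f g u v

/-- The restriction maps of an atomic sheaf are injective. -/
theorem IsAtomicSheaf.map_injective {C : Type u} [Category.{v} C] {P : Cᵒᵖ ⥤ Type w}
    (hP : IsAtomicSheaf P) {X Y : C} (c : Y ⟶ X) : Function.Injective (P.map c.op) := by
  intro x x' h
  refine (hP c (P.map c.op x) fun Z d e hde => ?_).unique rfl h
  simp only [← Functor.map_comp_apply, ← op_comp, hde]

/-- Over an independent square, the restriction of a compatible pair along a morphism into `Y`
is determined, after pulling back along an independent pullback, by its second component. -/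
theorem IsAtomicSheaf.map_map_eq {C : Type u} [Category.{v} C] {P : Cᵒᵖ ⥤ Type w}
    (hP : IsAtomicSheaf P) (S : IndepStructure C) {X Y Z W V A : C} {f : X ⟶ Y} {g : X ⟶ Z}
    {u : Y ⟶ W} {v : Z ⟶ W} (hs : S.Ind f g u v) {y : P.obj (op Y)} {z : P.obj (op Z)}
    (hyz : P.map f.op y = P.map g.op z) (d : V ⟶ Y) {r : A ⟶ Z} {a : A ⟶ V}
    (hA : S.IsIndepPullback r a v (d ≫ u)) :
    P.map a.op (P.map d.op y) = P.map r.op z := by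
  obtain ⟨B, b, b', hB, -⟩ := S.ip5 f d
  obtain ⟨k, ⟨hk, hk'⟩, -⟩ := hA.2 _ _ (S.ip3 hB (S.ip2 hs))
  apply hP.map_injective k
  calc P.map k.op (P.map a.op (P.map d.op y))
      _ = P.map (b ≫ f).op y := by
        simp only [← Functor.map_comp_apply, ← op_comp, S.comm hB, ← hk', Category.assoc]
      _ = P.map (b ≫ g).op z := by
        simp only [op_comp, Functor.map_comp_apply, hyz]
      _ = P.map k.op (P.map r.op z) := by
        simp only [← Functor.map_comp_apply, ← op_comp, hk]

/-- over a small category with an independent pullback structure, a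
presheaf is an atomic sheaf iff it maps independent squares to pullbacks in `Set`. -/
theorem stmt_9 {C : Type u} [SmallCategory C] (S : IndepStructure C)
    (P : Cᵒᵖ ⥤ Type u) :
    IsAtomicSheaf P ↔
    (∀ {X Y Z W : C} (f : X ⟶ Y) (g : X ⟶ Z) (u : Y ⟶ W) (v : Z ⟶ W),
      S.Ind f g u v → ∀ (y : P.obj (op Y)) (z : P.obj (op Z)),
        P.map f.op y = P.map g.op z →
        ∃! w : P.obj (op W), P.map u.op w = y ∧ P.map v.op w = z) := by
  constructor
  · intro hP X Y Z W f g u v hs y z hyz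
    have hinv : ∀ ⦃V : C⦄ (d e : V ⟶ Y), d ≫ u = e ≫ u →
        P.map d.op y = P.map e.op y := by
      intro V d e hde
      obtain ⟨A, r, a, hA⟩ := S.ip5 v (d ≫ u)
      apply hP.map_injective a
      rw [hP.map_map_eq S hs hyz d hA, hP.map_map_eq S hs hyz e (hde ▸ hA)]
    obtain ⟨w, rfl, -⟩ := hP u y hinv
    refine ⟨w, ⟨rfl, hP.map_injective g ?_⟩, fun w' hw' => hP.map_injective u hw'.1⟩
    rw [← hyz]
    simp only [← Functor.map_comp_apply, ← op_comp, S.comm hs]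
  · intro h X Y c y hy
    obtain ⟨A, f, g, hfg, -⟩ := S.ip5 c c
    obtain ⟨x, hx, hu⟩ := h f g c c hfg y y (hy f g (S.comm hfg))
    exact ⟨x, hx.1.symm, fun x' hx' => hu x' ⟨hx'.symm, hx'.symm⟩⟩
end

section
/- Let C be a small category equipped with an independent pullback structure. Then the following are equivalent: (1) every representable presheaf on C is an atomic sheaf; (2) every independent square in C is a pushout in C. -/
open CategoryTheory Opposite

universe u v w

theorem isAtomicSheaf_yoneda_iff {C : Type u} [Category.{v} C] (T : C) :
    IsAtomicSheaf (yoneda.obj T) ↔ ∀ ⦃X Y : C⦄ (c : Y ⟶ X) (y : Y ⟶ T),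
      (∀ ⦃Z : C⦄ (d e : Z ⟶ Y), d ≫ c = e ≫ c → d ≫ y = e ≫ y) → ∃! x : X ⟶ T, y = c ≫ x :=
  Iff.rfl

theorem epi_of_isAtomicSheaf_yoneda {C : Type u} [Category.{v} C]
    (H : ∀ T : C, IsAtomicSheaf (yoneda.obj T)) {X Y : C} (c : Y ⟶ X) : Epi c where
  left_cancellation {T} x x' h :=
    ((isAtomicSheaf_yoneda_iff T).1 (H T) c (c ≫ x) fun _ d e hde => by
      rw [reassoc_of% hde]).unique rfl h

namespace IndepStructure

variable {C : Type u} [Category.{v} C] (S : IndepStructure C)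

theorem comp_eq_of_ind (hepi : ∀ {X Y : C} (c : Y ⟶ X), Epi c)
    {X Y Z W T V R : C} {f : X ⟶ Y} {g : X ⟶ Z} {u : Y ⟶ W} {v : Z ⟶ W}
    (h : S.Ind f g u v) {a : Y ⟶ T} {b : Z ⟶ T} (hab : f ≫ a = g ≫ b) (d : V ⟶ Y)
    {q : R ⟶ Z} {p : R ⟶ V} (hR : S.IsIndepPullback q p v (d ≫ u)) :
    p ≫ d ≫ a = q ≫ b := by
  obtain ⟨Q, r, s, hQ, -⟩ := S.ip5 f d
  obtain ⟨k, ⟨hkq, hkp⟩, -⟩ := hR.2 _ _ (S.ip3 hQ (S.ip2 h))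
  have := hepi k
  rw [← cancel_epi k, reassoc_of% hkp, reassoc_of% hkq, ← hab, reassoc_of% S.comm hQ]

theorem isPushout_of_isAtomicSheaf_yoneda (H : ∀ T : C, IsAtomicSheaf (yoneda.obj T))
    {X Y Z W : C} {f : X ⟶ Y} {g : X ⟶ Z} {u : Y ⟶ W} {v : Z ⟶ W}
    (h : S.Ind f g u v) : IsPushout f g u v := by
  have hepi : ∀ {X Y : C} (c : Y ⟶ X), Epi c := epi_of_isAtomicSheaf_yoneda H
  have desc : ∀ {T : C} (a : Y ⟶ T) (b : Z ⟶ T), f ≫ a = g ≫ b → ∃ x : W ⟶ T, u ≫ x = a := by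
    intro T a b hab
    obtain ⟨x, hx, -⟩ := (isAtomicSheaf_yoneda_iff T).1 (H T) u a fun V d e hde => by
      obtain ⟨R, q, p, hR⟩ := S.ip5 v (d ≫ u)
      have := hepi p
      rw [← cancel_epi p, S.comp_eq_of_ind hepi h hab d hR,
        S.comp_eq_of_ind hepi h hab e (hde ▸ hR)]
    exact ⟨x, hx.symm⟩
  have := hepi g
  have := hepi u
  refine ⟨⟨S.comm h⟩, ⟨Limits.PushoutCocone.IsColimit.mk _
    (fun s => (desc s.inl s.inr s.condition).choose)
    (fun s => (desc s.inl s.inr s.condition).choose_spec) (fun s => ?_) fun s m hm _ => ?_⟩⟩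
  · rw [← cancel_epi g, ← reassoc_of% S.comm h,
      (desc s.inl s.inr s.condition).choose_spec, s.condition]
  · rw [← cancel_epi u, hm, (desc s.inl s.inr s.condition).choose_spec]

theorem isAtomicSheaf_yoneda_of_isPushout
    (H : ∀ {X Y Z W : C} (f : X ⟶ Y) (g : X ⟶ Z) (u : Y ⟶ W) (v : Z ⟶ W),
      S.Ind f g u v → IsPushout f g u v) (T : C) : IsAtomicSheaf (yoneda.obj T) := by
  rw [isAtomicSheaf_yoneda_iff]
  intro X Y c y hy
  obtain ⟨P, d, e, hP, -⟩ := S.ip5 c c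
  have hpo := H _ _ _ _ hP
  exact ⟨hpo.desc y y (hy d e hpo.w), (hpo.inl_desc _ _ _).symm, fun x hx =>
    hpo.hom_ext (by simp [hx]) (by simp [hx])⟩

end IndepStructure

/-- over a small category with an independent pullback structure, every
representable presheaf is an atomic sheaf iff every independent square is a pushout. -/
theorem stmt_10 {C : Type u} [SmallCategory C] (S : IndepStructure C) :
    (∀ Z : C, IsAtomicSheaf (yoneda.obj Z)) ↔
    (∀ {X Y Z W : C} (f : X ⟶ Y) (g : X ⟶ Z) (u : Y ⟶ W) (v : Z ⟶ W),
      S.Ind f g u v → IsPushout f g u v) :=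
  ⟨fun H _ _ _ _ _ _ _ _ h => S.isPushout_of_isAtomicSheaf_yoneda H h,
    S.isAtomicSheaf_yoneda_of_isPushout⟩
end

section
/- Let C be a small category in which every morphism is an epimorphism, let P be a presheaf on C that has supports, let x ∈ P(X) and q: Y → X a morphism in C. Then a triple (Z, s, x') (with s: X → Z and x' ∈ P(Z)) is a support for x if and only if (Z, s∘q, x') is a support for x·q. -/
open CategoryTheory Opposite

universe u v w

/-- `(Z, s, x')` is a support of `x ∈ P(X)`: a terminal representable factorisation. -/
def IsSupport {C : Type u} [Category.{v} C] (P : Cᵒᵖ ⥤ Type w) {X : C}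
    (x : P.obj (op X)) (Z : C) (s : X ⟶ Z) (x' : P.obj (op Z)) : Prop :=
  x = P.map s.op x' ∧
  ∀ (Y : C) (q : X ⟶ Y) (y : P.obj (op Y)), x = P.map q.op y →
    ∃ r : Y ⟶ Z, q ≫ r = s ∧ P.map r.op x' = y

/-- A presheaf has supports if every element has a support. -/
def HasSupports {C : Type u} [Category.{v} C] (P : Cᵒᵖ ⥤ Type w) : Prop :=
  ∀ (X : C) (x : P.obj (op X)), ∃ (Z : C) (s : X ⟶ Z) (x' : P.obj (op Z)),
    IsSupport P x Z s x'

/-- if all morphisms of `C` are epic and `P` has supports, then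
`(Z, s, x')` is a support for `x` iff `(Z, s ∘ q, x')` is a support for `x·q`. -/
theorem stmt_12 {C : Type u} [SmallCategory C]
    (hepi : ∀ {X Y : C} (f : X ⟶ Y), Epi f)
    (P : Cᵒᵖ ⥤ Type u) (hP : HasSupports P)
    {X Y : C} (x : P.obj (op X)) (q : Y ⟶ X)
    (Z : C) (s : X ⟶ Z) (x' : P.obj (op Z)) :
    IsSupport P x Z s x' ↔ IsSupport P (P.map q.op x) Z (q ≫ s) x' := by
  have := hepi q
  constructor
  · rintro ⟨hx, hs⟩
    refine ⟨by simp [hx], fun W t y hy => ?_⟩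
    obtain ⟨Z₀, s₀, x₀, -, h₀⟩ := hP Y (P.map q.op x)
    obtain ⟨r, hqr, hr⟩ := h₀ X q x rfl
    obtain ⟨h, hrh, hh⟩ := hs Z₀ r x₀ hr.symm
    obtain ⟨k, htk, hk⟩ := h₀ W t y hy
    refine ⟨k ≫ h, ?_, ?_⟩
    · rw [← Category.assoc, htk, ← hqr, Category.assoc, hrh]
    · simp [hh, hk]
  · rintro ⟨-, hs⟩
    obtain ⟨r, hqr, hr⟩ := hs X q x rfl
    obtain rfl : r = s := (cancel_epi q).1 hqr
    refine ⟨hr.symm, fun W t y hy => ?_⟩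
    obtain ⟨k, hk, hk'⟩ := hs W (q ≫ t) y (by simp [hy])
    exact ⟨k, (cancel_epi q).1 (by rw [← hk, Category.assoc]), hk'⟩
end

section
/- For every set A, the presheaf NV(A) on 𝕊ur has supports: for every nonempty finite set Ω and function X: Ω → A, factorising X as Ω --p--> Ω' --X'--> A with p surjective and X' injective (e.g., Ω' = X(Ω), p the corestriction of X, X' the inclusion), the triple (Ω', p, X') is a support for X. -/
/-- the presheaf `NV(A)` on 𝕊ur has supports: the surjective/injective
factorisation `X = X' ∘ p` of `X : Ω → A` is a support for `X`, i.e. a terminal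
representable factorisation. -/
theorem stmt_14 (A : Type) (Ω : Type) [Finite Ω] [Nonempty Ω] (X : Ω → A)
    (Ω' : Type) [Finite Ω'] [Nonempty Ω'] (p : Ω → Ω') (X' : Ω' → A)
    (hp : Function.Surjective p) (hX' : Function.Injective X') (hfac : X = X' ∘ p) :
    ∀ (Ω'' : Type) [Finite Ω''] [Nonempty Ω''] (q : Ω → Ω'') (Y : Ω'' → A),
      Function.Surjective q → X = Y ∘ q →
      ∃ r : Ω'' → Ω', Function.Surjective r ∧ r ∘ q = p ∧ X' ∘ r = Y := by
  intro Ω'' _ _ q Y hq hY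
  have hcomm : X' ∘ p ∘ Function.surjInv hq = Y := by
    rw [← Function.comp_assoc, ← hfac, hY, Function.comp_assoc,
      (Function.rightInverse_surjInv hq).comp_eq_id, Function.comp_id]
  have hfactor : (p ∘ Function.surjInv hq) ∘ q = p := by
    apply hX'.comp_left
    change (X' ∘ p ∘ Function.surjInv hq) ∘ q = X' ∘ p
    rw [hcomm, ← hY, hfac]
  exact ⟨p ∘ Function.surjInv hq, Function.Surjective.of_comp (hfactor ▸ hp), hfactor, hcomm⟩
end

section
/- Every atomic sheaf on the category 𝕊ur has supports: for every atomic sheaf P on 𝕊ur, every nonempty finite set Ω and every x ∈ P(Ω), x has a support. -/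
open CategoryTheory Opposite

universe u v w

/-- Objects of the category 𝕊ur: nonempty finite sets. -/
structure SurObj : Type 1 where
  carrier : Type
  [fin : Finite carrier]
  [ne : Nonempty carrier]

attribute [instance] SurObj.fin SurObj.ne

/-- The category 𝕊ur of nonempty finite sets and surjective functions. -/
instance : Category SurObj where
  Hom X Y := {f : X.carrier → Y.carrier // Function.Surjective f}
  id X := ⟨id, Function.surjective_id⟩
  comp f g := ⟨g.1 ∘ f.1, g.2.comp f.2⟩

theorem presheaf_map_comp_apply {C : Type u} [Category.{v} C] (P : Cᵒᵖ ⥤ Type w) {X Y Z : C}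
    (f : X ⟶ Y) (g : Y ⟶ Z) (x : P.obj (op Z)) :
    P.map (f ≫ g).op x = P.map f.op (P.map g.op x) := by
  simp

namespace SurObj

theorem hom_ext {X Y : SurObj} {f g : X ⟶ Y} (h : ∀ a, f.1 a = g.1 a) : f = g :=
  Subtype.ext (funext h)

theorem comp_val {X Y Z : SurObj} (f : X ⟶ Y) (g : Y ⟶ Z) (a : X.carrier) :
    (f ≫ g).1 a = g.1 (f.1 a) := rfl

/-- The disjoint union of an object with itself. -/
def double (Z : SurObj) : SurObj := ⟨Z.carrier ⊕ Z.carrier⟩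

/-- The codiagonal map. -/
def fold (Z : SurObj) : double Z ⟶ Z := ⟨Sum.elim id id, fun z => ⟨Sum.inl z, rfl⟩⟩

/-- The equivalence relation generated by the kernels of all the maps through which `x` factors. -/
def supportSetoid (P : SurObjᵒᵖ ⥤ Type w) {X : SurObj} (x : P.obj (op X)) : Setoid X.carrier :=
  sSup {s | ∃ (Y : SurObj) (q : X ⟶ Y) (y : P.obj (op Y)), x = P.map q.op y ∧ s = Setoid.ker q.1}

theorem ker_le_supportSetoid (P : SurObjᵒᵖ ⥤ Type w) {X Y : SurObj} {x : P.obj (op X)}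
    {q : X ⟶ Y} {y : P.obj (op Y)} (h : x = P.map q.op y) :
    Setoid.ker q.1 ≤ supportSetoid P x :=
  le_sSup ⟨Y, q, y, h, rfl⟩

/-- In a family of surjections `k a` that differ only at points where `k a` takes the value `a`,
`x` has the same restriction along members with `supportSetoid`-related indices. -/
theorem map_eq_of_update (P : SurObjᵒᵖ ⥤ Type w) {W X : SurObj} (x : P.obj (op X))
    (k : X.carrier → (W ⟶ X))
    (hk : ∀ a b w, (k a).1 w = (k b).1 w ∨ (k a).1 w = a ∧ (k b).1 w = b)
    {a b : X.carrier} (hab : supportSetoid P x a b) :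
    P.map (k a).op x = P.map (k b).op x := by
  have hle : supportSetoid P x ≤ Setoid.ker fun a => P.map (k a).op x := by
    refine sSup_le ?_
    rintro _ ⟨Y, q, y, h, rfl⟩ a b hab
    change P.map (k a).op x = P.map (k b).op x
    have hq : k a ≫ q = k b ≫ q := by
      refine hom_ext fun w => ?_
      rw [comp_val, comp_val]
      rcases hk a b w with h | ⟨h, h'⟩
      · rw [h]
      · rw [h, h']
        exact hab
    rw [h, ← presheaf_map_comp_apply, ← presheaf_map_comp_apply, hq]
  exact hle hab

open Classical in
/-- Any number of points of a surjection may be moved within `supportSetoid`-classes,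
provided surjectivity is witnessed on a set of points that are left fixed. -/
theorem map_eq_of_fixed (P : SurObjᵒᵖ ⥤ Type w) {W X : SurObj} (x : P.obj (op X))
    (A : Set W.carrier) (g g' : W ⟶ X) (hA : ∀ a, ∃ w ∈ A, g.1 w = a)
    (hfix : ∀ w ∈ A, g.1 w = g'.1 w) (hrel : ∀ w, supportSetoid P x (g.1 w) (g'.1 w)) :
    P.map g.op x = P.map g'.op x := by
  have := Fintype.ofFinite W.carrier
  have surj : ∀ h : W.carrier → X.carrier, (∀ w ∈ A, g.1 w = h w) → Function.Surjective h :=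
    fun h hh a => (hA a).elim fun w hw => ⟨w, (hh w hw.1).symm.trans hw.2⟩
  have key : ∀ (s : Finset W.carrier) (h : W ⟶ X), (∀ w, h.1 w = if w ∈ s then g'.1 w else g.1 w) →
      P.map g.op x = P.map h.op x := by
    intro s
    induction s using Finset.induction_on with
    | empty =>
      intro h hh
      rw [hom_ext (f := g) (g := h) fun w => by simp [hh]]
    | insert z s hz ih =>
      intro h hh
      by_cases hzA : z ∈ A
      · refine ih h fun w => ?_
        rw [hh]
        by_cases hw : w = z
        · subst hw
          simp [hz, hfix w hzA]
        · simp [hw]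
      · let k : X.carrier → (W ⟶ X) := fun a =>
          ⟨Function.update h.1 z a, surj _ fun w hw => by
            have hwz : w ≠ z := fun e => hzA (e ▸ hw)
            rw [Function.update_of_ne hwz, hh]
            split_ifs
            exacts [hfix w hw, rfl]⟩
        have hk := map_eq_of_update P x k (fun a b w => by
          by_cases hw : w = z
          · subst hw
            simp [k]
          · simp [k, hw]) (hrel z)
        rw [ih (k (g.1 z)) fun w => ?_, hk, hom_ext (f := k (g'.1 z)) (g := h) fun w => ?_]
        · by_cases hw : w = z
          · subst hw
            simp [k, hh]
          · simp [k, hw]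
        · by_cases hw : w = z
          · subst hw
            simp [k, hz]
          · simp [k, hw, hh]
  exact key Finset.univ g' fun w => by simp

theorem map_eq_of_supportSetoid {P : SurObjᵒᵖ ⥤ Type w} (hP : IsAtomicSheaf P) {X Z : SurObj}
    (x : P.obj (op X)) (f f' : Z ⟶ X) (hrel : ∀ z, supportSetoid P x (f.1 z) (f'.1 z)) :
    P.map f.op x = P.map f'.op x := by
  let m : double Z ⟶ X := ⟨Sum.elim f'.1 f.1, fun a => (f.2 a).elim fun z hz => ⟨Sum.inr z, hz⟩⟩
  refine hP.map_injective (fold Z) ?_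
  rw [← presheaf_map_comp_apply, ← presheaf_map_comp_apply]
  trans P.map m.op x
  · refine map_eq_of_fixed P x (Set.range Sum.inr) _ _ ?_ ?_ ?_
    · intro a
      obtain ⟨z, hz⟩ := f.2 a
      exact ⟨_, ⟨z, rfl⟩, hz⟩
    · rintro _ ⟨z, rfl⟩
      rfl
    · rintro (z | z)
      exacts [hrel z, (supportSetoid P x).refl _]
  · refine map_eq_of_fixed P x (Set.range Sum.inl) _ _ ?_ ?_ ?_
    · intro a
      obtain ⟨z, hz⟩ := f'.2 a
      exact ⟨_, ⟨z, rfl⟩, hz⟩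
    · rintro _ ⟨z, rfl⟩
      rfl
    · rintro (z | z)
      exacts [(supportSetoid P x).refl _, hrel z]

end SurObj

/-- every atomic sheaf on 𝕊ur has supports. -/
theorem stmt_16 (P : SurObjᵒᵖ ⥤ Type w) (hP : IsAtomicSheaf P) : HasSupports P := by
  intro X x
  have : Nonempty (_root_.Quotient (SurObj.supportSetoid P x)) :=
    Nonempty.map (Quotient.mk _) X.ne
  let Z : SurObj := ⟨_root_.Quotient (SurObj.supportSetoid P x)⟩
  let s : X ⟶ Z := ⟨Quotient.mk (SurObj.supportSetoid P x), Quotient.mk_surjective⟩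
  obtain ⟨x', hx', -⟩ := hP s x fun W d e h =>
    SurObj.map_eq_of_supportSetoid hP x d e fun w =>
      Quotient.exact (congrFun (congrArg Subtype.val h) w)
  refine ⟨Z, s, x', hx', fun Y q y hy => ?_⟩
  have hker : ∀ a b, q.1 a = q.1 b → s.1 a = s.1 b := fun a b hab =>
    Quotient.sound (SurObj.ker_le_supportSetoid P hy hab)
  have hinv : ∀ a, s.1 (Function.surjInv q.2 (q.1 a)) = s.1 a := fun a =>
    hker _ _ (Function.surjInv_eq q.2 _)
  let r : Y ⟶ Z := ⟨fun b => s.1 (Function.surjInv q.2 b), fun c =>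
    (s.2 c).elim fun a ha => ⟨q.1 a, (hinv a).trans ha⟩⟩
  have hr : q ≫ r = s := SurObj.hom_ext hinv
  refine ⟨r, hr, hP.map_injective q ?_⟩
  rw [← presheaf_map_comp_apply, hr, ← hx', hy]
end

section
/- For all sets A, B, C, a nonempty finite set Ω and functions X: Ω → A, Y: Ω → B, Z: Ω → C, the following are equivalent: (i) X ⫫ Y | Z; (ii) there exist nonempty finite sets Ω_X, Ω_Y, Ω_Z, surjections p: Ω → Ω_X, q: Ω → Ω_Y, r: Ω_X → Ω_Z, s: Ω_Y → Ω_Z with r∘p = s∘q such that the square is a weak pullback in Set (for all a ∈ Ω_X, b ∈ Ω_Y with r(a) = s(b) there is ω ∈ Ω with p(ω) = a and q(ω) = b), together with functions X': Ω_X → A with X'∘p = X, Y': Ω_Y → B with Y'∘q = Y, and an injective function Z': Ω_Z → C with Z'∘r∘p = Z. Hence the atomic conditional independence relation on the sheaves NV(A), NV(B), NV(C) in Sh_at(𝕊ur) coincides with the multiteam conditional independence relation. -/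
/-- multiteam conditional independence `X ⫫ Y | Z` holds iff there is an
independent square (weak pullback) of surjections under `Ω` together with factorisations
`X' ∘ p = X`, `Y' ∘ q = Y` and a support `(Ω_Z, r ∘ p, Z')` (with `Z'` injective) of `Z`.
Hence atomic conditional independence in `Sh_at(𝕊ur)` coincides with the multiteam one. -/
theorem stmt_18 (A B C : Type) (Ω : Type) [Finite Ω] [Nonempty Ω]
    (X : Ω → A) (Y : Ω → B) (Z : Ω → C) :
    CondIndep X Y Z ↔
    ∃ (ΩX ΩY ΩZ : Type) (_ : Finite ΩX) (_ : Nonempty ΩX) (_ : Finite ΩY)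
      (_ : Nonempty ΩY) (_ : Finite ΩZ) (_ : Nonempty ΩZ)
      (p : Ω → ΩX) (q : Ω → ΩY) (r : ΩX → ΩZ) (s : ΩY → ΩZ),
      Function.Surjective p ∧ Function.Surjective q ∧ Function.Surjective r ∧
      Function.Surjective s ∧ r ∘ p = s ∘ q ∧
      (∀ (a : ΩX) (b : ΩY), r a = s b → ∃ ω, p ω = a ∧ q ω = b) ∧
      ∃ (X' : ΩX → A) (Y' : ΩY → B) (Z' : ΩZ → C),
        X' ∘ p = X ∧ Y' ∘ q = Y ∧ Function.Injective Z' ∧ Z' ∘ r ∘ p = Z := by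
  constructor
  · intro h
    let r : Set.range (fun ω => (X ω, Z ω)) → Set.range Z :=
      fun a => ⟨a.1.2, by obtain ⟨_, ω, rfl⟩ := a; exact ⟨ω, rfl⟩⟩
    let s : Set.range (fun ω => (Y ω, Z ω)) → Set.range Z :=
      fun b => ⟨b.1.2, by obtain ⟨_, ω, rfl⟩ := b; exact ⟨ω, rfl⟩⟩
    refine ⟨_, _, _, inferInstance, inferInstance, inferInstance, inferInstance,
      inferInstance, inferInstance, Set.rangeFactorization (fun ω => (X ω, Z ω)),
      Set.rangeFactorization (fun ω => (Y ω, Z ω)), r, s,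
      Set.rangeFactorization_surjective, Set.rangeFactorization_surjective,
      ?_, ?_, rfl, ?_, fun a => a.1.1, fun b => b.1.1, Subtype.val, rfl, rfl,
      Subtype.val_injective, rfl⟩
    · rintro ⟨_, ω, rfl⟩
      exact ⟨⟨_, ω, rfl⟩, rfl⟩
    · rintro ⟨_, ω, rfl⟩
      exact ⟨⟨_, ω, rfl⟩, rfl⟩
    · rintro ⟨_, ω₁, rfl⟩ ⟨_, ω₂, rfl⟩ hrs
      have hZ : Z ω₁ = Z ω₂ := congrArg Subtype.val hrs
      obtain ⟨ω, hX, hY, hZω⟩ := h (X ω₁) (Y ω₂) (Z ω₁) ⟨ω₁, rfl, rfl⟩ ⟨ω₂, rfl, hZ.symm⟩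
      exact ⟨ω, Subtype.ext (Prod.ext hX hZω), Subtype.ext (Prod.ext hY (hZω.trans hZ))⟩
  · rintro ⟨ΩX, ΩY, ΩZ, -, -, -, -, -, -, p, q, r, s, -, -, -, -, hsq, hpb,
      X', Y', Z', rfl, rfl, hZ', rfl⟩
    rintro _ _ _ ⟨ω₁, rfl, rfl⟩ ⟨ω₂, rfl, hZ⟩
    have hrs : r (p ω₁) = s (q ω₂) := (hZ' hZ).symm.trans (congrFun hsq ω₂)
    obtain ⟨ω, hp, hq⟩ := hpb (p ω₁) (q ω₂) hrs
    exact ⟨ω, congrArg X' hp, congrArg Y' hq, congrArg (Z' ∘ r) hp⟩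
end

section
/- Let 𝕀 be the category of finite sets and injective functions, and let P be an atomic sheaf on 𝕀^op (equivalently, a covariant functor P: 𝕀 → Set preserving pullbacks). For every finite set X and all x, y ∈ P(X), the pair (x, y) belongs to the atomic equivalence relation ~_P(X) (i.e., there exist a finite set Z and injections j, j': X → Z with P(j)(x) = P(j')(y)) if and only if there exists an injective (hence bijective) function i: X → X with y = P(i)(x). -/
open CategoryTheory

/-- Objects of the category 𝕀: finite sets. -/
structure FinInjObj : Type 1 where
  carrier : Type
  [fin : Finite carrier]

attribute [instance] FinInjObj.fin

/-- The category 𝕀 of finite sets and injective functions. -/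
instance : Category FinInjObj where
  Hom X Y := {f : X.carrier → Y.carrier // Function.Injective f}
  id X := ⟨id, Function.injective_id⟩
  comp f g := ⟨g.1 ∘ f.1, g.2.comp f.2⟩

namespace FinInjObj

/-- The atomic sheaf condition, stated covariantly. -/
def IsAtomicSheaf (P : FinInjObj ⥤ Type) : Prop :=
  ∀ ⦃X Y : FinInjObj⦄ (c : X ⟶ Y) (y : P.obj Y),
    (∀ ⦃Z : FinInjObj⦄ (d e : Y ⟶ Z), c ≫ d = c ≫ e → P.map d y = P.map e y) →
    ∃! x : P.obj X, y = P.map c x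

theorem IsAtomicSheaf.map_injective {P : FinInjObj ⥤ Type} (hP : IsAtomicSheaf P)
    {X Y : FinInjObj} (c : X ⟶ Y) : Function.Injective (P.map c) := by
  intro a b hab
  refine (hP c (P.map c a) fun Z d e h => ?_).unique rfl hab
  rw [← Functor.map_comp_apply, ← Functor.map_comp_apply, h]

/-- The pushout-like extension of `d : X ⟶ V` along `j : X ⟶ Z`. -/
noncomputable def extendAlong {X V Z : FinInjObj} (j : X ⟶ Z) (d : X ⟶ V) :
    Z ⟶ ⟨V.carrier ⊕ Z.carrier⟩ :=
  ⟨Function.extend j.1 (Sum.inl ∘ d.1) Sum.inr, by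
    intro z z' h
    by_cases hz : ∃ a, j.1 a = z <;> by_cases hz' : ∃ a, j.1 a = z'
    · obtain ⟨a, rfl⟩ := hz
      obtain ⟨b, rfl⟩ := hz'
      rw [j.2.extend_apply, j.2.extend_apply] at h
      rw [d.2 (Sum.inl_injective h)]
    · obtain ⟨a, rfl⟩ := hz
      rw [j.2.extend_apply, Function.extend_apply' _ _ _ hz'] at h
      simp at h
    · obtain ⟨b, rfl⟩ := hz'
      rw [j.2.extend_apply, Function.extend_apply' _ _ _ hz] at h
      simp at h
    · rw [Function.extend_apply' _ _ _ hz, Function.extend_apply' _ _ _ hz'] at h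
      exact Sum.inr_injective h⟩

/-- The inclusion of `V` into the disjoint union `V ⊕ Z`. -/
def inl (V Z : FinInjObj) : V ⟶ ⟨V.carrier ⊕ Z.carrier⟩ := ⟨Sum.inl, Sum.inl_injective⟩

theorem comp_extendAlong {X V Z : FinInjObj} (j : X ⟶ Z) (d : X ⟶ V) :
    j ≫ extendAlong j d = d ≫ inl V Z :=
  Subtype.ext (funext fun a => j.2.extend_apply _ _ a)

theorem IsAtomicSheaf.exists_of_pullback {P : FinInjObj ⥤ Type} (hP : IsAtomicSheaf P)
    {W X Y Z : FinInjObj} (p : W ⟶ X) (q : W ⟶ Y) (j : X ⟶ Z) (j' : Y ⟶ Z)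
    (hpq : p ≫ j = q ≫ j') (hW : ∀ a b, j.1 a = j'.1 b → ∃ w, p.1 w = a)
    (x : P.obj X) (y : P.obj Y) (hxy : P.map j x = P.map j' y) :
    ∃ w : P.obj W, x = P.map p w ∧ y = P.map q w := by
  obtain ⟨w, hw, -⟩ := hP p x fun V d e hde => by
    apply hP.map_injective (inl V Z)
    have key : j' ≫ extendAlong j d = j' ≫ extendAlong j e := by
      refine Subtype.ext (funext fun b => ?_)
      change Function.extend j.1 _ _ (j'.1 b) = Function.extend j.1 _ _ (j'.1 b)
      by_cases hb : ∃ a, j.1 a = j'.1 b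
      · obtain ⟨a, ha⟩ := hb
        obtain ⟨w, rfl⟩ := hW a b ha
        rw [← ha, j.2.extend_apply, j.2.extend_apply]
        exact congrArg Sum.inl (congrFun (congrArg Subtype.val hde) w)
      · rw [Function.extend_apply' _ _ _ hb, Function.extend_apply' _ _ _ hb]
    rw [← Functor.map_comp_apply, ← Functor.map_comp_apply, ← comp_extendAlong j d,
      ← comp_extendAlong j e, Functor.map_comp_apply, Functor.map_comp_apply, hxy,
      ← Functor.map_comp_apply, ← Functor.map_comp_apply, key]
  refine ⟨w, hw, hP.map_injective j' ?_⟩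
  rw [← hxy, hw, ← Functor.map_comp_apply, ← Functor.map_comp_apply, hpq]

theorem exists_comp_eq {W X : FinInjObj} (p q : W ⟶ X) : ∃ i : X ⟶ X, p ≫ i = q := by
  classical
  let e : {a // a ∈ Set.range p.1} ≃ {a // a ∈ Set.range q.1} :=
    (Equiv.ofInjective p.1 p.2).symm.trans (Equiv.ofInjective q.1 q.2)
  refine ⟨⟨e.extendSubtype, e.extendSubtype.injective⟩, Subtype.ext (funext fun w => ?_)⟩
  refine (e.extendSubtype_apply_of_mem (p.1 w) ⟨w, rfl⟩).trans ?_
  change q.1 ((Equiv.ofInjective p.1 p.2).symm ⟨p.1 w, _⟩) = q.1 w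
  rw [Equiv.ofInjective_symm_apply]

end FinInjObj

/-- let `P` be a covariant functor `𝕀 ⥤ Type` which, viewed as a presheaf
on `𝕀ᵒᵖ`, is an atomic sheaf (the atomic-sheaf condition is stated here covariantly).
Then for `x, y ∈ P(X)`, atomic equivalence `(x, y) ∈ ~_P(X)` (existence of injections
`j, j' : X → Z` with `P(j)(x) = P(j')(y)`) holds iff there is an injective (hence
bijective) function `i : X → X` with `y = P(i)(x)`. -/
theorem stmt_19 (P : FinInjObj ⥤ Type)
    (hP : ∀ ⦃X Y : FinInjObj⦄ (c : X ⟶ Y) (y : P.obj Y),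
      (∀ ⦃Z : FinInjObj⦄ (d e : Y ⟶ Z), c ≫ d = c ≫ e → P.map d y = P.map e y) →
      ∃! x : P.obj X, y = P.map c x)
    (X : FinInjObj) (x y : P.obj X) :
    (∃ (Z : FinInjObj) (j j' : X ⟶ Z), P.map j x = P.map j' y) ↔
    (∃ i : X ⟶ X, y = P.map i x) := by
  have hS : FinInjObj.IsAtomicSheaf P := hP
  constructor
  · rintro ⟨Z, j, j', h⟩
    let W : FinInjObj := ⟨{a : X.carrier // ∃ b, j'.1 b = j.1 a}⟩
    choose g hg using fun a : W.carrier => a.2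
    let p : W ⟶ X := ⟨Subtype.val, Subtype.val_injective⟩
    let q : W ⟶ X := ⟨g, fun a b hab => by
      apply Subtype.ext
      apply j.2
      rw [← hg, ← hg, hab]⟩
    obtain ⟨w, rfl, rfl⟩ := hS.exists_of_pullback p q j j'
      (Subtype.ext (funext fun a => (hg a).symm))
      (fun a b hab => ⟨⟨a, b, hab.symm⟩, rfl⟩) x y h
    obtain ⟨i, hi⟩ := FinInjObj.exists_comp_eq p q
    exact ⟨i, by rw [← Functor.map_comp_apply, hi]⟩
  · rintro ⟨i, rfl⟩
    exact ⟨X, i, 𝟙 X, by simp⟩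
end
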